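/- Let f be an H-constant n-cochain on A ⋊ H. Then f(a⁰⊗h⁰, …, a^{n-1}⊗h^{n-1}, aⁿ⊗hⁿh) = f(h₍₁₎(a⁰)⊗h₍₂₎h⁰, a¹⊗h¹, …, aⁿ⊗hⁿ) for all a^i ∈ A, h^i, h ∈ H. (This 'wrap-around' identity uses the vanishing of bf with 1⊗h inserted in the last slot.) -/

import Mathlib

noncomputable section

open TensorProduct

variable {H A : Type} [Ring H] [HopfAlgebra ℂ H] [Ring A] [Algebra ℂ A]

/-- `sweedler N Δ₁ Δ₂ k g F` is the Sweedler sum `Σ F (g₍₁₎, …, g₍ₖ₊₁₎)`, computed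
from a chosen finite representation `comul g = Σ_{i < N g} Δ₁ g i ⊗ Δ₂ g i` of the
comultiplication. -/
def sweedler (N : H → ℕ) (Δ₁ Δ₂ : H → ℕ → H) :
    (k : ℕ) → H → ((Fin (k+1) → H) → ℂ) → ℂ
  | 0, g, F => F ![g]
  | k+1, g, F => ∑ i ∈ Finset.range (N g),
      sweedler N Δ₁ Δ₂ k (Δ₂ g i) (fun v => F (Fin.cons (Δ₁ g i) v))

/-- The multiplication of the crossed product `A ⋊ H`, as a linear map on
`(A ⊗ H) ⊗ (A ⊗ H)`; on pure tensors it is `(a ⊗ h)(b ⊗ g) = a h₍₁₎(b) ⊗ h₍₂₎ g`. -/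
def cpMul (ρ : H →ₗ[ℂ] A →ₗ[ℂ] A) :
    (A ⊗[ℂ] H) ⊗[ℂ] (A ⊗[ℂ] H) →ₗ[ℂ] A ⊗[ℂ] H :=
  (LinearMap.rTensor H (LinearMap.mul' ℂ A)) ∘ₗ
  (TensorProduct.assoc ℂ A A H).symm.toLinearMap ∘ₗ
  (LinearMap.lTensor A (TensorProduct.map (TensorProduct.lift ρ) (LinearMap.mul' ℂ H))) ∘ₗ
  (LinearMap.lTensor A (TensorProduct.tensorTensorTensorComm ℂ H H A H).toLinearMap) ∘ₗ
  (LinearMap.lTensor A (LinearMap.rTensor (A ⊗[ℂ] H) (Coalgebra.comul (R := ℂ)))) ∘ₗ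
  (TensorProduct.assoc ℂ A H (A ⊗[ℂ] H)).toLinearMap

/-- The tuple obtained from `x` by replacing the pair `(xʲ, xʲ⁺¹)` by the single
entry `y` (used with `y = xʲ xʲ⁺¹` for the `j`-th face map). -/
def faceTup {α : Type} {n : ℕ} (j : Fin (n+1)) (y : α) (x : Fin (n+2) → α) :
    Fin (n+1) → α :=
  fun k => if (k : ℕ) < (j : ℕ) then x k.castSucc else if k = j then y else x k.succ

/-- The `i`-th term of the product `(p.1 ⊗ p.2)(q.1 ⊗ q.2)` in `A ⋊ H`, for the chosen
representation of the comultiplication: `p.1 · (Δ₁ p.2 i)(q.1) ⊗ (Δ₂ p.2 i) q.2`. -/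
def cpPairTerm (Δ₁ Δ₂ : H → ℕ → H) (ρ : H →ₗ[ℂ] A →ₗ[ℂ] A) (p q : A × H) (i : ℕ) :
    A × H :=
  (p.1 * ρ (Δ₁ p.2 i) q.1, Δ₂ p.2 i * q.2)

/-- The Hochschild coboundary of a cochain on the crossed product `A ⋊ H`. -/
def cpb (ρ : H →ₗ[ℂ] A →ₗ[ℂ] A) {n : ℕ} (f : (Fin (n+1) → A ⊗[ℂ] H) → ℂ) :
    (Fin (n+2) → A ⊗[ℂ] H) → ℂ := fun x =>
  (∑ j : Fin (n+1), (-1 : ℂ) ^ (j : ℕ) *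
      f (faceTup j (cpMul ρ (x j.castSucc ⊗ₜ[ℂ] x j.succ)) x))
  + (-1 : ℂ) ^ (n+1) *
      f (fun k => if (k : ℕ) = 0 then cpMul ρ (x (Fin.last (n+1)) ⊗ₜ[ℂ] x 0)
                  else x k.castSucc)

/-- `f` vanishes whenever some argument in position `≥ 1` lies in the subalgebra
`1 ⊗ H` of `A ⋊ H`. -/
def HConstVanish {m : ℕ} (f : (Fin m → A ⊗[ℂ] H) → ℂ) : Prop :=
  ∀ x : Fin m → A ⊗[ℂ] H,
    (∃ j : Fin m, 0 < (j : ℕ) ∧ ∃ h : H, x j = (1 : A) ⊗ₜ[ℂ] h) → f x = 0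

/-- An `H`-constant cochain on `A ⋊ H`: both `f` and `bf` vanish whenever some
argument in position `≥ 1` lies in `1 ⊗ H`. -/
def IsHConstant (ρ : H →ₗ[ℂ] A →ₗ[ℂ] A) {n : ℕ}
    (f : MultilinearMap ℂ (fun _ : Fin (n+1) => A ⊗[ℂ] H) ℂ) : Prop :=
  HConstVanish ⇑f ∧ HConstVanish (cpb ρ ⇑f)

/-- Auxiliary recursion for `Ψ`: processes the pairs `x¹, …, xᵏ`, keeping an
accumulated Hopf algebra element `g`; at each step `Δg = g₍₁₎ ⊗ g₍₂₎` is split, the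
current slot becomes `g₍₁₎(aʲ)` and the accumulator becomes `g₍₂₎ hʲ`. -/
def psiAux (N : H → ℕ) (Δ₁ Δ₂ : H → ℕ → H) (ρ : H →ₗ[ℂ] A →ₗ[ℂ] A) :
    (k : ℕ) → H → (Fin k → A × H) → (H → (Fin k → A) → ℂ) → ℂ
  | 0, g, _, F => F g ![]
  | k+1, g, x, F => ∑ i ∈ Finset.range (N g),
      psiAux N Δ₁ Δ₂ ρ k (Δ₂ g i * (x 0).2) (fun j => x j.succ)
        (fun h v => F h (Fin.cons (ρ (Δ₁ g i) (x 0).1) v))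

/-- The value of `Ψφ` on the elementary tensors `a⁰ ⊗ h⁰, …, aⁿ ⊗ hⁿ`:
`Ψ(φ)(a⁰⊗h⁰, …, aⁿ⊗hⁿ) = φ(h⁰₍ₙ₊₁₎ ⋯ h^{n-1}₍₂₎ hⁿ, a⁰, h⁰₍₁₎(a¹), …,
h⁰₍ₙ₎⋯h^{n-1}₍₁₎(aⁿ))`. -/
def psiV (N : H → ℕ) (Δ₁ Δ₂ : H → ℕ → H) (ρ : H →ₗ[ℂ] A →ₗ[ℂ] A) {n : ℕ}
    (φf : H → (Fin (n+1) → A) → ℂ) (x : Fin (n+1) → A × H) : ℂ :=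
  psiAux N Δ₁ Δ₂ ρ n ((x 0).2) (fun j => x j.succ)
    (fun h v => φf h (Fin.cons (x 0).1 v))

/-- The equivariance condition `φ(S(g₍₂₎) h g₍₁₎, a⁰, …, aⁿ) =
φ(h, g₍₁₎(a⁰), …, g₍ₙ₊₁₎(aⁿ))` for a cochain `φ : H ⊗ A^{⊗(n+1)} → ℂ`. -/
def IsEquivariant (N : H → ℕ) (Δ₁ Δ₂ : H → ℕ → H) (ρ : H →ₗ[ℂ] A →ₗ[ℂ] A) {n : ℕ}
    (φf : H → (Fin (n+1) → A) → ℂ) : Prop :=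
  ∀ (g h : H) (a : Fin (n+1) → A),
    sweedler N Δ₁ Δ₂ 1 g
      (fun ℓ => φf (HopfAlgebra.antipode (R := ℂ) (ℓ 1) * h * ℓ 0) a)
      = sweedler N Δ₁ Δ₂ n g (fun ℓ => φf h (fun j => ρ (ℓ j) (a j)))

/-- The cyclic operator on equivariant cochains:
`t φ(h, a⁰, …, aⁿ) = φ(h₍₂₎, S⁻¹(h₍₁₎)(aⁿ), a⁰, …, aⁿ⁻¹)`. -/
def cycOpEq (N : H → ℕ) (Δ₁ Δ₂ : H → ℕ → H) (ρ : H →ₗ[ℂ] A →ₗ[ℂ] A)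
    (Sinv : H →ₗ[ℂ] H) {n : ℕ} (φf : H → (Fin (n+1) → A) → ℂ) :
    H → (Fin (n+1) → A) → ℂ := fun h a =>
  sweedler N Δ₁ Δ₂ 1 h (fun ℓ =>
    φf (ℓ 1) (Fin.cons (ρ (Sinv (ℓ 0)) (a (Fin.last n))) (fun j : Fin n => a j.castSucc)))

/-- The map `Φ`: `(Φf)(h, a⁰, …, aⁿ) = f(a⁰ ⊗ 1, …, aⁿ⁻¹ ⊗ 1, aⁿ ⊗ h)`. -/
def phiV {n : ℕ} (f : MultilinearMap ℂ (fun _ : Fin (n+1) => A ⊗[ℂ] H) ℂ) :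
    H → (Fin (n+1) → A) → ℂ := fun h a =>
  f (fun i => if i = Fin.last n then a i ⊗ₜ[ℂ] h else a i ⊗ₜ[ℂ] (1 : H))


theorem cpMul_aux (N : H → ℕ) (Δ₁ Δ₂ : H → ℕ → H)
    (hrep : ∀ g : H, (Coalgebra.comul (R := ℂ) g : H ⊗[ℂ] H) =
      ∑ i ∈ Finset.range (N g), Δ₁ g i ⊗ₜ[ℂ] Δ₂ g i)
    (ρ : H →ₗ[ℂ] A →ₗ[ℂ] A) (a b : A) (h g : H) :
    cpMul ρ ((a ⊗ₜ[ℂ] h) ⊗ₜ[ℂ] (b ⊗ₜ[ℂ] g)) =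
      ∑ i ∈ Finset.range (N h), (a * ρ (Δ₁ h i) b) ⊗ₜ[ℂ] (Δ₂ h i * g) := by
  simp [cpMul, hrep, TensorProduct.sum_tmul, TensorProduct.tmul_sum, map_sum]

theorem cpMul_one_aux (N : H → ℕ) (Δ₁ Δ₂ : H → ℕ → H)
    (hrep : ∀ g : H, (Coalgebra.comul (R := ℂ) g : H ⊗[ℂ] H) =
      ∑ i ∈ Finset.range (N g), Δ₁ g i ⊗ₜ[ℂ] Δ₂ g i)
    (ρ : H →ₗ[ℂ] A →ₗ[ℂ] A)
    (hact_one : ∀ h : H, ρ h 1 = (Coalgebra.counit (R := ℂ) h) • (1 : A))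
    (a : A) (h g : H) :
    cpMul ρ ((a ⊗ₜ[ℂ] h) ⊗ₜ[ℂ] ((1 : A) ⊗ₜ[ℂ] g)) = a ⊗ₜ[ℂ] (h * g) := by
  rw [cpMul_aux N Δ₁ Δ₂ hrep]
  have h1 : ∑ i ∈ Finset.range (N h), Coalgebra.counit (R := ℂ) (Δ₁ h i) • Δ₂ h i = h := by
    have := Coalgebra.rTensor_counit_comul (R := ℂ) h
    rw [hrep, map_sum] at this
    have h2 := congrArg (TensorProduct.lid ℂ H) this
    simpa [map_sum] using h2
  conv_rhs => rw [← h1]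
  rw [Finset.sum_mul, TensorProduct.tmul_sum]
  refine Finset.sum_congr rfl fun i _ => ?_
  rw [hact_one, mul_smul_comm, mul_one, smul_mul_assoc, TensorProduct.smul_tmul]

/-- For an `H`-constant `n`-cochain `f` on `A ⋊ H`, the wrap-around
identity: `f(a⁰ ⊗ h⁰, …, aⁿ⁻¹ ⊗ hⁿ⁻¹, aⁿ ⊗ hⁿh) = f(h₍₁₎(a⁰) ⊗ h₍₂₎h⁰, a¹ ⊗ h¹, …, aⁿ ⊗ hⁿ)`. -/
theorem statement14 {n : ℕ}
    (N : H → ℕ) (Δ₁ Δ₂ : H → ℕ → H)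
    (hrep : ∀ g : H, (Coalgebra.comul (R := ℂ) g : H ⊗[ℂ] H) =
      ∑ i ∈ Finset.range (N g), Δ₁ g i ⊗ₜ[ℂ] Δ₂ g i)
    (ρ : H →ₗ[ℂ] A →ₗ[ℂ] A)
    (hρ_one : ρ 1 = LinearMap.id)
    (hρ_mul : ∀ g h : H, ρ (g * h) = ρ g ∘ₗ ρ h)
    (hact_mul : ∀ (h : H) (a b : A),
      ρ h (a * b) = ∑ i ∈ Finset.range (N h), ρ (Δ₁ h i) a * ρ (Δ₂ h i) b)
    (hact_one : ∀ h : H, ρ h 1 = (Coalgebra.counit (R := ℂ) h) • (1 : A))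
    (f : MultilinearMap ℂ (fun _ : Fin (n+1) => A ⊗[ℂ] H) ℂ)
    (hf : IsHConstant ρ f) :
    ∀ (a : Fin (n+1) → A) (hs : Fin (n+1) → H) (h : H),
      f (Function.update (fun j => a j ⊗ₜ[ℂ] hs j) (Fin.last n)
          (a (Fin.last n) ⊗ₜ[ℂ] (hs (Fin.last n) * h)))
      = ∑ i ∈ Finset.range (N h),
          f (Function.update (fun j => a j ⊗ₜ[ℂ] hs j) 0
              (ρ (Δ₁ h i) (a 0) ⊗ₜ[ℂ] (Δ₂ h i * hs 0))) := by
  intro a hs h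
  obtain ⟨hv, hb⟩ := hf
  set X : Fin (n+1) → A ⊗[ℂ] H := fun j => a j ⊗ₜ[ℂ] hs j with hX
  have h0 := hb (Fin.snoc (α := fun _ => A ⊗[ℂ] H) X ((1 : A) ⊗ₜ[ℂ] h))
    ⟨Fin.last (n+1), by simp, h, by simp⟩
  unfold cpb at h0
  rw [Fin.sum_univ_castSucc, Finset.sum_eq_zero, zero_add] at h0
  · have e1 : faceTup (Fin.last n) (cpMul ρ
        ((Fin.snoc (α := fun _ => A ⊗[ℂ] H) X ((1 : A) ⊗ₜ[ℂ] h) : Fin (n+2) → A ⊗[ℂ] H)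
            (Fin.last n).castSucc ⊗ₜ[ℂ]
          (Fin.snoc (α := fun _ => A ⊗[ℂ] H) X ((1 : A) ⊗ₜ[ℂ] h) : Fin (n+2) → A ⊗[ℂ] H)
            (Fin.last n).succ)) (Fin.snoc (α := fun _ => A ⊗[ℂ] H) X ((1 : A) ⊗ₜ[ℂ] h))
        = Function.update X (Fin.last n)
          (a (Fin.last n) ⊗ₜ[ℂ] (hs (Fin.last n) * h)) := by
      funext k
      rw [Fin.snoc_castSucc, Fin.succ_last, Fin.snoc_last,
        cpMul_one_aux N Δ₁ Δ₂ hrep ρ hact_one]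
      unfold faceTup
      by_cases hk : k = Fin.last n
      · subst hk; simp
      · have : (k : ℕ) < n := by
          have := Fin.val_lt_last hk
          simpa using this
        rw [Function.update_of_ne hk, if_pos (by simpa using this), Fin.snoc_castSucc]
    have e2 : (fun k : Fin (n+1) => if (k : ℕ) = 0 then cpMul ρ
        ((Fin.snoc (α := fun _ => A ⊗[ℂ] H) X ((1 : A) ⊗ₜ[ℂ] h) : Fin (n+2) → A ⊗[ℂ] H)
            (Fin.last (n+1)) ⊗ₜ[ℂ]
          (Fin.snoc (α := fun _ => A ⊗[ℂ] H) X ((1 : A) ⊗ₜ[ℂ] h) : Fin (n+2) → A ⊗[ℂ] H) 0)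
        else (Fin.snoc (α := fun _ => A ⊗[ℂ] H) X ((1 : A) ⊗ₜ[ℂ] h) : Fin (n+2) → A ⊗[ℂ] H)
            k.castSucc)
        = Function.update X 0 (∑ i ∈ Finset.range (N h),
            ρ (Δ₁ h i) (a 0) ⊗ₜ[ℂ] (Δ₂ h i * hs 0)) := by
      funext k
      rw [← Fin.castSucc_zero, Fin.snoc_castSucc, Fin.snoc_last, Fin.snoc_castSucc,
        cpMul_aux N Δ₁ Δ₂ hrep ρ]
      by_cases hk : k = 0
      · subst hk; simp
      · rw [Function.update_of_ne hk, if_neg (fun hk0 : (k : ℕ) = 0 => hk (Fin.ext hk0))]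
    rw [e1, e2, MultilinearMap.map_update_sum, Fin.val_last, pow_succ] at h0
    have hne : (-1 : ℂ) ^ n ≠ 0 := pow_ne_zero _ (by norm_num)
    apply mul_left_cancel₀ hne
    linear_combination h0
  · intro j _
    rw [hv, mul_zero]
    have hj := j.isLt
    refine ⟨Fin.last n, by rw [Fin.val_last]; omega, h, ?_⟩
    unfold faceTup
    rw [if_neg (by rw [Fin.val_last, Fin.val_castSucc]; omega),
      if_neg (by rw [Fin.ext_iff, Fin.val_last, Fin.val_castSucc]; omega), Fin.succ_last,
      Fin.snoc_last]

end
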